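/- Let n ≥ 4 be an integer and let k ≥ 1 be an integer. For every δ > 0 there exists a function h satisfying hypotheses (H) such that simultaneously σ_(k+1)(g_h) − σ_(k)(g_h) < δ and σ_(k+1)(g_h)/σ_(k)(g_h) > λ_(k+1)/λ_(k) − δ; that is, the Steklov spectral ratio can approach its supremum λ_(k+1)/λ_(k) while the spectral gap tends to zero. -/

import Mathlib

open MeasureTheory Set

/-- Hypotheses (H): `h` is smooth on `[0,R]`, positive on `[0,R)`, `h(R)=0`,
`h'(R) = -1`, and all even-order derivatives of `h` vanish at `R`. -/
def SatisfiesH (R : ℝ) (h : ℝ → ℝ) : Prop :=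
  ContDiffOn ℝ (⊤ : ℕ∞) h (Set.Icc 0 R) ∧
  (∀ r ∈ Set.Ico (0:ℝ) R, 0 < h r) ∧
  h R = 0 ∧
  derivWithin h (Set.Icc 0 R) R = -1 ∧
  ∀ k : ℕ, iteratedDerivWithin (2 * k) h (Set.Icc 0 R) R = 0

/-- The `k`-th distinct eigenvalue `λ_(k) = k (n + k - 2)` of the Laplacian on the
round unit sphere `S^{n-1}`. -/
noncomputable def sphereEig (n k : ℕ) : ℝ := (k : ℝ) * ((n : ℝ) + (k : ℝ) - 2)

/-- The Rayleigh quotient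
`R_λ(a; h) = (∫₀^R ((a')² h^{n-1} + λ a² h^{n-3}))/(a(0)² h(0)^{n-1})`. -/
noncomputable def rayleighQ (R : ℝ) (n : ℕ) (lam : ℝ) (h a : ℝ → ℝ) : ℝ :=
  (∫ r in (0:ℝ)..R,
      (deriv a r) ^ 2 * h r ^ ((n : ℤ) - 1) + lam * (a r) ^ 2 * h r ^ ((n : ℤ) - 3)) /
    ((a 0) ^ 2 * h 0 ^ ((n : ℤ) - 1))

/-- Admissible test functions: Lipschitz on `[0,R]`, vanishing at `R`, nonzero at `0`. -/
def IsAdmissible (R : ℝ) (a : ℝ → ℝ) : Prop :=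
  (∃ K : NNReal, LipschitzOnWith K a (Set.Icc 0 R)) ∧ a R = 0 ∧ a 0 ≠ 0

/-- The `k`-th distinct Steklov eigenvalue of the ball `[0,R] × S^{n-1}` with the
revolution metric `g_h`, characterized variationally. -/
noncomputable def steklov (R : ℝ) (n k : ℕ) (h : ℝ → ℝ) : ℝ :=
  sInf { v : ℝ | ∃ a : ℝ → ℝ, IsAdmissible R a ∧ v = rayleighQ R n (sphereEig n k) h a }

/-- `a` is a minimizer realizing `σ_(k)(g_h)`. -/
def IsMinimizer (R : ℝ) (n k : ℕ) (h a : ℝ → ℝ) : Prop :=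
  IsAdmissible R a ∧ rayleighQ R n (sphereEig n k) h a = steklov R n k h


/-- The profile `h(r) = s + A s³`, `s = R - r`. -/
noncomputable def prof (R A r : ℝ) : ℝ := (R - r) + A * (R - r) ^ 3

lemma prof_contDiff (R A : ℝ) {n : WithTop ℕ∞} : ContDiff ℝ n (prof R A) := by
  unfold prof; fun_prop

lemma prof_cont (R A : ℝ) : Continuous (prof R A) := by
  unfold prof; fun_prop

lemma prof_pos {R A r : ℝ} (hA : 0 ≤ A) (hr : r < R) : 0 < prof R A r := by
  have : 0 < R - r := by linarith
  unfold prof; positivity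

lemma prof_nonneg {R A r : ℝ} (hA : 0 ≤ A) (hr : r ≤ R) : 0 ≤ prof R A r := by
  have : 0 ≤ R - r := by linarith
  unfold prof; positivity

lemma prof_anti {R A r t : ℝ} (hA : 0 ≤ A) (hrt : r ≤ t) (ht : t ≤ R) :
    prof R A t ≤ prof R A r := by
  have h1 : 0 ≤ R - t := by linarith
  have h2 : R - t ≤ R - r := by linarith
  unfold prof; gcongr

lemma prof_H {R A : ℝ} (hR : 0 < R) (hA : 0 ≤ A) : SatisfiesH R (prof R A) := by
  have hmem : R ∈ Icc 0 R := ⟨hR.le, le_rfl⟩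
  refine ⟨(prof_contDiff R A).contDiffOn, fun r hr => prof_pos hA hr.2, by simp [prof], ?_, ?_⟩
  · rw [DifferentiableAt.derivWithin ((prof_contDiff R A (n := 1)).differentiable (by simp)).differentiableAt
      (uniqueDiffOn_Icc hR R hmem)]
    have h : HasDerivAt (prof R A) ((-1) + A * (3 * (R - R) ^ 2 * (-1))) R := by
      have h1 : HasDerivAt (fun r => R - r) (-1) R := by
        simpa using (hasDerivAt_id R).const_sub R
      simpa [prof] using! h1.add ((h1.pow 3).const_mul A)
    rw [h.deriv]; simp
  · intro k
    rw [iteratedDerivWithin_eq_iteratedDeriv (uniqueDiffOn_Icc hR) (prof_contDiff R A).contDiffAt hmem]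
    have e1 : prof R A = fun r => (fun x : ℝ => -(x + A * x ^ 3)) (r - R) := by
      funext r; unfold prof; ring
    have key : iteratedDeriv (2 * k) (fun x : ℝ => -(x + A * x ^ 3)) 0 = 0 := by
      have h1 := iteratedDeriv_comp_neg (2 * k) (fun x : ℝ => -(x + A * x ^ 3)) 0
      have h2 : (fun x : ℝ => (fun x : ℝ => -(x + A * x ^ 3)) (-x)) =
          -(fun x : ℝ => -(x + A * x ^ 3)) := by
        funext x; simp only [Pi.neg_apply]; ring
      rw [h2, iteratedDeriv_neg] at h1
      simp at h1
      simp; linarith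
    have h3 := congrFun (iteratedDeriv_comp_sub_const (2 * k) (fun x : ℝ => -(x + A * x ^ 3)) R) R
    rw [e1]
    refine h3.trans ?_
    simpa using key

lemma lip_int {R : ℝ} (hR : 0 < R) {a : ℝ → ℝ} {K : NNReal} (ha : LipschitzOnWith K a (Icc 0 R)) :
    IntervalIntegrable (fun r => (deriv a r) ^ 2) volume 0 R := by
  rw [intervalIntegrable_iff_integrableOn_Ioo_of_le hR.le]
  refine Measure.integrableOn_of_bounded (M := (K:ℝ)^2) (by simp)
    ((measurable_deriv a).pow_const 2).aestronglyMeasurable ?_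
  refine (ae_restrict_iff' measurableSet_Ioo).2 (Filter.Eventually.of_forall fun r hr => ?_)
  have := norm_deriv_le_of_lipschitzOn (Icc_mem_nhds hr.1 hr.2) ha
  rw [norm_pow]; gcongr

lemma energy_int {R A lam : ℝ} (hR : 0 < R) {a : ℝ → ℝ} {K : NNReal} (m : ℕ)
    (ha : LipschitzOnWith K a (Icc 0 R)) :
    IntervalIntegrable (fun r => (deriv a r) ^ 2 * prof R A r ^ (m + 3)
      + lam * (a r) ^ 2 * prof R A r ^ (m + 1)) volume 0 R := by
  have hc := prof_cont R A
  refine ((lip_int hR ha).mul_continuousOn (hc.pow _).continuousOn).add ?_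
  apply ContinuousOn.intervalIntegrable
  rw [uIcc_of_le hR.le]
  have := ha.continuousOn
  fun_prop

lemma alg {lam η P Q d x w : ℝ} (hP : 0 < P)
    (hWW : (lam * (1 - η) * w) ^ 2 ≤ lam * η * (Q * P)) :
    -(lam * (1 - η)) * (2 * x * d * w - x ^ 2 * Q) ≤ d ^ 2 * P + lam * x ^ 2 * Q := by
  set c := lam * (1 - η) with hcdef
  have h1 : 0 ≤ d ^ 2 * P + 2 * x * d * (c * w) + lam * η * x ^ 2 * Q := by
    have h2 : 0 ≤ P * (d ^ 2 * P + 2 * x * d * (c * w) + lam * η * x ^ 2 * Q) := by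
      have h4 := mul_le_mul_of_nonneg_left hWW (sq_nonneg x)
      have h5 := sq_nonneg (d * P + x * (c * w))
      nlinarith
    exact nonneg_of_mul_nonneg_right h2 hP
  have h3 : c * (x ^ 2 * Q) = lam * x ^ 2 * Q - lam * η * x ^ 2 * Q := by rw [hcdef]; ring
  have h6 : -c * (2 * x * d * w - x ^ 2 * Q) = -(2 * x * d * (c * w)) + c * (x ^ 2 * Q) := by ring
  rw [h6]; linarith

lemma lower {R A lam η ε : ℝ} (hR : 0 < R) (hA : 0 ≤ A) (hε : 0 < ε) (hεR : ε ≤ R)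
    (hη : 0 < η) (hη1 : η ≤ 1) (hlam : 0 < lam) (hK : lam ≤ η * (1 + A * ε ^ 2) ^ 2)
    {a : ℝ → ℝ} {K : NNReal} (m : ℕ)
    (ha : LipschitzOnWith K a (Icc 0 R)) :
    lam * (1 - η) * (a 0 ^ 2 * ∫ r in (0:ℝ)..(R - ε), prof R A r ^ (m + 1)) ≤
    ∫ r in (0:ℝ)..R, ((deriv a r) ^ 2 * prof R A r ^ (m + 3)
      + lam * (a r) ^ 2 * prof R A r ^ (m + 1)) := by
  set b := R - ε with hb
  have hb0 : 0 ≤ b := by linarith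
  have hbR : b ≤ R := by linarith
  have hc := prof_cont R A
  have hcm : Continuous fun r => prof R A r ^ (m + 1) := hc.pow _
  let W : ℝ → ℝ := fun r => ∫ t in r..b, prof R A t ^ (m + 1)
  have hW : ∀ r, HasDerivAt W (-(prof R A r ^ (m + 1))) r := fun r =>
    intervalIntegral.integral_hasDerivAt_left (hcm.intervalIntegrable _ _)
      (hcm.stronglyMeasurableAtFilter _ _) hcm.continuousAt
  have hWac : AbsolutelyContinuousOnInterval W 0 b := by
    apply ContDiffOn.absolutelyContinuousOnInterval
    apply ContDiff.contDiffOn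
    rw [contDiff_one_iff_deriv]
    refine ⟨fun r => (hW r).differentiableAt, ?_⟩
    rw [show deriv W = fun r => -(prof R A r ^ (m + 1)) from funext fun r => (hW r).deriv]
    exact hcm.neg
  have haac : AbsolutelyContinuousOnInterval a 0 b := by
    apply LipschitzOnWith.absolutelyContinuousOnInterval (K := K)
    rw [uIcc_of_le hb0]
    exact ha.mono (Icc_subset_Icc_right hbR)
  have hG := (haac.fun_mul haac).fun_mul hWac
  have hint := hG.integral_deriv_eq_sub
  have hWb : W b = 0 := by simp [W]
  have hE := energy_int (A := A) (lam := lam) hR m ha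
  have hsub : uIcc 0 b ⊆ uIcc 0 R := by
    rw [uIcc_of_le hb0, uIcc_of_le hR.le]; exact Icc_subset_Icc_right hbR
  have step1 : ∫ r in (0:ℝ)..b, (-(lam * (1 - η))) * deriv (fun x => a x * a x * W x) r ≤
      ∫ r in (0:ℝ)..b, ((deriv a r) ^ 2 * prof R A r ^ (m + 3)
      + lam * (a r) ^ 2 * prof R A r ^ (m + 1)) := by
    apply intervalIntegral.integral_mono_ae_restrict hb0
      (hG.intervalIntegrable_deriv.const_mul _) (hE.mono_set hsub)
    rw [Filter.EventuallyLE, ae_restrict_iff' measurableSet_Icc]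
    filter_upwards [haac.ae_differentiableAt] with r hr hr'
    have hd := (hr (by rwa [uIcc_of_le hb0])).hasDerivAt
    have hD := ((hd.mul hd).mul (hW r)).deriv
    have hrR : r < R := by linarith [hr'.2]
    have hp := prof_pos hA hrR
    have hW0 : 0 ≤ W r := by
      apply intervalIntegral.integral_nonneg hr'.2
      intro t ht
      exact pow_nonneg (prof_nonneg hA (ht.2.trans hbR)) _
    have hW1 : W r ≤ (R - r) * prof R A r ^ (m + 1) := by
      have : W r ≤ ∫ t in r..b, prof R A r ^ (m + 1) := by
        apply intervalIntegral.integral_mono_on hr'.2 (hcm.intervalIntegrable _ _) (by simp)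
        intro t ht
        exact pow_le_pow_left₀ (prof_nonneg hA (ht.2.trans hbR))
          (prof_anti hA ht.1 (ht.2.trans hbR)) _
      rw [intervalIntegral.integral_const, smul_eq_mul] at this
      refine this.trans ?_
      gcongr
    have hD' : deriv (fun x => a x * a x * W x) r =
        2 * a r * deriv a r * W r - a r ^ 2 * prof R A r ^ (m + 1) := by
      have e : (fun x => a x * a x * W x) = a * a * W := rfl
      rw [e, hD]; simp only [Pi.mul_apply]; ring
    rw [hD']
    set p := prof R A r with hpdef
    set c := lam * (1 - η) with hcdef
    have hpe : p = (R - r) * (1 + A * (R - r) ^ 2) := by rw [hpdef, prof]; ring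
    have hs : ε ≤ R - r := by linarith [hr'.2]
    have hps : lam * (R - r) ^ 2 ≤ η * p ^ 2 := by
      have : lam ≤ η * (1 + A * (R - r) ^ 2) ^ 2 := hK.trans (by gcongr)
      rw [hpe]; nlinarith [mul_le_mul_of_nonneg_right this (sq_nonneg (R - r))]
    have hc0 : 0 ≤ c := mul_nonneg hlam.le (by linarith)
    have hcl : c ≤ lam := by nlinarith
    have hWW : (c * W r) ^ 2 ≤ lam * η * (p ^ (m + 1) * p ^ (m + 3)) := by
      calc (c * W r) ^ 2 ≤ (lam * ((R - r) * p ^ (m + 1))) ^ 2 := by gcongr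
        _ = lam * (lam * (R - r) ^ 2) * (p ^ (m + 1)) ^ 2 := by ring
        _ ≤ lam * (η * p ^ 2) * (p ^ (m + 1)) ^ 2 := by gcongr
        _ = _ := by ring
    have hP : 0 < p ^ (m + 3) := by positivity
    have hQ : 0 < p ^ (m + 1) := by positivity
    exact alg hP hWW
  have step2 : ∫ r in (0:ℝ)..b, ((deriv a r) ^ 2 * prof R A r ^ (m + 3)
      + lam * (a r) ^ 2 * prof R A r ^ (m + 1)) ≤ 
      ∫ r in (0:ℝ)..R, ((deriv a r) ^ 2 * prof R A r ^ (m + 3)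
      + lam * (a r) ^ 2 * prof R A r ^ (m + 1)) := by
    apply intervalIntegral.integral_mono_interval le_rfl hb0 hbR _ hE
    refine (ae_restrict_iff' measurableSet_Ioc).2 (Filter.Eventually.of_forall fun r hr => ?_)
    have := prof_nonneg hA hr.2
    simp only [Pi.zero_apply]
    positivity
  refine le_trans (le_of_eq ?_) (step1.trans step2)
  rw [intervalIntegral.integral_const_mul, hint, hWb]
  simp only [W]; ring

lemma upper {R A lam ε : ℝ} (hR : 0 < R) (hA : 0 ≤ A) (hε : 0 < ε) (hεR : ε ≤ R)
    (hlam : 0 < lam) (m : ℕ) :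
    ∃ a : ℝ → ℝ, IsAdmissible R a ∧ a 0 = 1 ∧ 
    ∫ r in (0:ℝ)..R, ((deriv a r) ^ 2 * prof R A r ^ (m + 3)
      + lam * (a r) ^ 2 * prof R A r ^ (m + 1)) ≤
    lam * (∫ r in (0:ℝ)..R, prof R A r ^ (m + 1)) +
      ε * ((1 / ε) ^ 2 * prof R A (R - ε) ^ (m + 3)) := by
  let a : ℝ → ℝ := fun r => min ((R - r) * (1 / ε)) 1
  have ha0 : a 0 = 1 := by
    simp only [a, sub_zero]
    apply min_eq_right
    rw [mul_one_div, one_le_div hε]; exact hεR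
  have hL : LipschitzWith (max (1 / ε).toNNReal 0) a := by
    apply LipschitzWith.min _ (LipschitzWith.const _)
    apply LipschitzWith.of_dist_le_mul
    intro x y
    rw [Real.dist_eq, Real.dist_eq, Real.coe_toNNReal _ (by positivity), ← sub_mul, abs_mul,
      abs_of_pos (show 0 < 1 / ε by positivity), mul_comm]
    apply le_of_eq; congr 1
    rw [abs_sub_comm]; congr 1; ring
  have hLo := hL.lipschitzOnWith (s := Icc 0 R)
  refine ⟨a, ⟨⟨_, hLo⟩, by simp [a], by rw [ha0]; exact one_ne_zero⟩, ha0, ?_⟩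
  have hE := energy_int (A := A) (lam := lam) hR m hLo
  set b := R - ε with hb
  have hb0 : 0 ≤ b := by linarith
  have hbR : b ≤ R := by linarith
  have hc := prof_cont R A
  have hcm : Continuous fun r => prof R A r ^ (m + 1) := hc.pow _
  have hs1 : uIcc 0 b ⊆ uIcc 0 R := by
    rw [uIcc_of_le hb0, uIcc_of_le hR.le]; exact Icc_subset_Icc_right hbR
  have hs2 : uIcc b R ⊆ uIcc 0 R := by
    rw [uIcc_of_le hbR, uIcc_of_le hR.le]; exact Icc_subset_Icc_left hb0
  rw [← intervalIntegral.integral_add_adjacent_intervals (hE.mono_set hs1) (hE.mono_set hs2),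
    ← intervalIntegral.integral_add_adjacent_intervals (hcm.intervalIntegrable 0 b)
      (hcm.intervalIntegrable b R)]
  have i1 : ∫ r in (0:ℝ)..b, ((deriv a r) ^ 2 * prof R A r ^ (m + 3)
      + lam * (a r) ^ 2 * prof R A r ^ (m + 1)) ≤ ∫ r in (0:ℝ)..b, lam * prof R A r ^ (m + 1) := by
    apply intervalIntegral.integral_mono_on_of_le_Ioo hb0 (hE.mono_set hs1)
      ((hcm.intervalIntegrable _ _).const_mul _)
    intro r hr
    have h1 : ∀ t < b, a t = 1 := by
      intro t ht
      apply min_eq_right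
      rw [mul_one_div, one_le_div hε]; linarith
    have h2 : a =ᶠ[nhds r] fun _ => (1:ℝ) := by
      filter_upwards [Iio_mem_nhds hr.2] with t ht using h1 t ht
    rw [h2.deriv_eq, h1 r hr.2]; simp
  have i2 : ∫ r in b..R, ((deriv a r) ^ 2 * prof R A r ^ (m + 3)
      + lam * (a r) ^ 2 * prof R A r ^ (m + 1)) ≤
      ∫ r in b..R, ((1 / ε) ^ 2 * prof R A b ^ (m + 3) + lam * prof R A r ^ (m + 1)) := by
    apply intervalIntegral.integral_mono_on_of_le_Ioo hbR (hE.mono_set hs2)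
      ((by simp : IntervalIntegrable (fun _ => (1 / ε) ^ 2 * prof R A b ^ (m + 3)) volume b R).add
        ((hcm.intervalIntegrable _ _).const_mul _))
    intro r hr
    have hp := prof_nonneg hA hr.2.le
    have hp' := prof_anti hA hr.1.le hr.2.le
    have hd : (deriv a r) ^ 2 ≤ (1 / ε) ^ 2 := by
      have := norm_deriv_le_of_lipschitz hL (x₀ := r)
      rw [max_eq_left (by simp), Real.coe_toNNReal _ (by positivity), Real.norm_eq_abs] at this
      exact sq_le_sq.2 (this.trans (le_abs_self _))
    have hn : 0 ≤ a r := le_min (mul_nonneg (by linarith [hr.2]) (by positivity)) zero_le_one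
    have hn' : a r ^ 2 ≤ 1 := pow_le_one₀ hn (min_le_right _ _)
    have h1 : lam * a r ^ 2 * prof R A r ^ (m + 1) ≤ lam * 1 * prof R A r ^ (m + 1) := by gcongr
    rw [mul_one] at h1
    gcongr
  rw [intervalIntegral.integral_const_mul] at i1
  rw [intervalIntegral.integral_add (by simp) ((hcm.intervalIntegrable _ _).const_mul _),
    intervalIntegral.integral_const_mul lam, intervalIntegral.integral_const, smul_eq_mul] at i2
  have : R - b = ε := by rw [hb]; ring
  rw [this] at i2
  linarith

lemma rayleigh_eq (R lam A : ℝ) (m : ℕ) (a : ℝ → ℝ) :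
    rayleighQ R (m + 4) lam (prof R A) a =
    (∫ r in (0:ℝ)..R, ((deriv a r) ^ 2 * prof R A r ^ (m + 3)
      + lam * (a r) ^ 2 * prof R A r ^ (m + 1))) / (a 0 ^ 2 * prof R A 0 ^ (m + 3)) := by
  have e1 : ((m + 4 : ℕ) : ℤ) - 1 = ((m + 3 : ℕ) : ℤ) := by push_cast; ring
  have e2 : ((m + 4 : ℕ) : ℤ) - 3 = ((m + 1 : ℕ) : ℤ) := by push_cast; ring
  unfold rayleighQ
  rw [e1, e2]
  simp only [zpow_natCast]

lemma energy_nonneg {R A lam : ℝ} (hR : 0 < R) (hA : 0 ≤ A) (hlam : 0 < lam) (m : ℕ) (a : ℝ → ℝ) :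
    0 ≤ ∫ r in (0:ℝ)..R, ((deriv a r) ^ 2 * prof R A r ^ (m + 3)
      + lam * (a r) ^ 2 * prof R A r ^ (m + 1)) := by
  apply intervalIntegral.integral_nonneg hR.le
  intro r hr
  have := prof_nonneg hA hr.2
  positivity

/-- Two-sided bound for the Steklov eigenvalues of the profile with `A ε² = K`. -/
lemma stek_bounds {R A η ε K : ℝ} (hR : 0 < R) (hA : 0 ≤ A) (hε : 0 < ε) (hεR : ε ≤ R)
    (hε1 : ε ≤ 1) (hη : 0 < η) (hη1 : η ≤ 1) (hAK : A * ε ^ 2 = K) (m k : ℕ)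
    (hlam : 0 < sphereEig (m + 4) k) (hK : sphereEig (m + 4) k ≤ η * (1 + K) ^ 2) :
    sphereEig (m + 4) k * (1 - η) *
        ((∫ r in (0:ℝ)..R, prof R A r ^ (m + 1)) - ε * (1 + K) ^ (m + 3)) / prof R A 0 ^ (m + 3)
      ≤ steklov R (m + 4) k (prof R A) ∧
    steklov R (m + 4) k (prof R A) ≤ (sphereEig (m + 4) k * (∫ r in (0:ℝ)..R, prof R A r ^ (m + 1))
      + ε * (1 + K) ^ (m + 3)) / prof R A 0 ^ (m + 3) := by
  have hp0 := prof_pos hA hR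
  have hD : 0 < prof R A 0 ^ (m + 3) := by positivity
  have hK0 : 0 ≤ K := by rw [← hAK]; positivity
  have hpe : prof R A (R - ε) = ε * (1 + K) := by rw [← hAK]; unfold prof; ring
  have hcm : Continuous fun r => prof R A r ^ (m + 1) := (prof_cont R A).pow _
  obtain ⟨a, ha, ha0, hub⟩ := upper (A := A) hR hA hε hεR hlam m
  have hpw : ε ^ (m + 1) ≤ 1 := pow_le_one₀ hε.le hε1
  constructor
  · refine le_csInf ⟨_, a, ha, rfl⟩ ?_
    rintro v ⟨c, ⟨⟨L, hc⟩, -, hc0⟩, rfl⟩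
    have hlow := lower (A := A) (η := η) hR hA hε hεR hη hη1 hlam (by rw [hAK]; exact hK) m hc
    have hc2 : 0 < c 0 ^ 2 := by positivity
    have htail : (∫ r in (R - ε)..R, prof R A r ^ (m + 1)) ≤ ε * (1 + K) ^ (m + 3) := by
      have h1 : (∫ r in (R - ε)..R, prof R A r ^ (m + 1)) ≤
          ∫ r in (R - ε)..R, prof R A (R - ε) ^ (m + 1) := by
        apply intervalIntegral.integral_mono_on (by linarith) (hcm.intervalIntegrable _ _) (by simp)
        intro r hr
        exact pow_le_pow_left₀ (prof_nonneg hA hr.2) (prof_anti hA hr.1 hr.2) _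
      rw [intervalIntegral.integral_const, smul_eq_mul, hpe, sub_sub_cancel, mul_pow] at h1
      refine h1.trans ?_
      gcongr
      calc ε ^ (m + 1) * (1 + K) ^ (m + 1) ≤ 1 * (1 + K) ^ (m + 3) := by
            gcongr
            · linarith
            · omega
        _ = _ := one_mul _
    have hsplit := intervalIntegral.integral_add_adjacent_intervals
      (hcm.intervalIntegrable (μ := volume) 0 (R - ε)) (hcm.intervalIntegrable (R - ε) R)
    rw [rayleigh_eq, div_le_div_iff₀ hD (by positivity)]
    have h1 : sphereEig (m + 4) k * (1 - η) *
        (c 0 ^ 2 * ((∫ r in (0:ℝ)..R, prof R A r ^ (m + 1)) - ε * (1 + K) ^ (m + 3))) ≤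
        sphereEig (m + 4) k * (1 - η) * (c 0 ^ 2 * ∫ r in (0:ℝ)..(R - ε), prof R A r ^ (m + 1)) := by
      have : 0 ≤ 1 - η := by linarith
      gcongr
      linarith
    have h2 := mul_le_mul_of_nonneg_right (h1.trans hlow) hD.le
    refine le_trans (le_of_eq ?_) h2
    ring
  · have hmem : rayleighQ R (m + 4) (sphereEig (m + 4) k) (prof R A) a ∈
      { v : ℝ | ∃ a : ℝ → ℝ, IsAdmissible R a ∧
        v = rayleighQ R (m + 4) (sphereEig (m + 4) k) (prof R A) a } := ⟨a, ha, rfl⟩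
    have hbdd : BddBelow { v : ℝ | ∃ a : ℝ → ℝ, IsAdmissible R a ∧
        v = rayleighQ R (m + 4) (sphereEig (m + 4) k) (prof R A) a } := by
      refine ⟨0, ?_⟩
      rintro v ⟨c, -, rfl⟩
      rw [rayleigh_eq]
      exact div_nonneg (energy_nonneg hR hA hlam m c) (by positivity)
    refine (csInf_le hbdd hmem).trans ?_
    rw [rayleigh_eq, ha0, one_pow, one_mul]
    gcongr
    refine hub.trans ?_
    gcongr
    rw [hpe, mul_pow]
    have : (1 / ε) ^ 2 * (ε ^ (m + 3) * (1 + K) ^ (m + 3)) = ε ^ (m + 1) * (1 + K) ^ (m + 3) := by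
      field_simp
      ring
    rw [this]
    calc ε ^ (m + 1) * (1 + K) ^ (m + 3) ≤ 1 * (1 + K) ^ (m + 3) := by gcongr
      _ = _ := one_mul _

set_option maxHeartbeats 2000000 in
theorem stmt_17 (n : ℕ) (hn : 4 ≤ n) (R : ℝ) (hR : 0 < R) (k : ℕ) (hk : 1 ≤ k) :
    ∀ δ : ℝ, 0 < δ → ∃ h : ℝ → ℝ, SatisfiesH R h ∧
      steklov R n (k + 1) h - steklov R n k h < δ ∧
      steklov R n (k + 1) h / steklov R n k h >
        sphereEig n (k + 1) / sphereEig n k - δ := by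
  intro δ hδ
  obtain ⟨m, rfl⟩ : ∃ m, n = m + 4 := ⟨n - 4, by omega⟩
  have hk' : (1:ℝ) ≤ k := by exact_mod_cast hk
  have hm' : (0:ℝ) ≤ m := by positivity
  have hl0 : 0 < sphereEig (m + 4) k := by
    unfold sphereEig; push_cast; apply mul_pos <;> linarith
  have hll : sphereEig (m + 4) k ≤ sphereEig (m + 4) (k + 1) := by
    unfold sphereEig; push_cast; nlinarith
  have hB := @stek_bounds R
  set l := sphereEig (m + 4) k with hl
  set l' := sphereEig (m + 4) (k + 1) with hl'
  have hl'0 : 0 < l' := hl0.trans_le hll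
  obtain ⟨η, hη, hη2, hηδ⟩ : ∃ η : ℝ, 0 < η ∧ η ≤ 1 / 2 ∧ l' / l * (3 * η) < δ := by
    refine ⟨min (1 / 2) (δ / (4 * (l' / l))), by positivity, min_le_left _ _, ?_⟩
    have h1 : min (1 / 2) (δ / (4 * (l' / l))) ≤ δ / (4 * (l' / l)) := min_le_right _ _
    have hr : 0 < l' / l := by positivity
    calc l' / l * (3 * min (1 / 2) (δ / (4 * (l' / l)))) ≤ l' / l * (3 * (δ / (4 * (l' / l)))) := by
          gcongr
      _ = 3 / 4 * δ := by field_simp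
      _ < δ := by linarith
  obtain ⟨K, hK1, hK⟩ : ∃ K : ℝ, 1 ≤ K ∧ l' ≤ η * (1 + K) ^ 2 := by
    refine ⟨1 + l' / η, by linarith [show 0 < l' / η by positivity], ?_⟩
    have h1 : l' = η * (l' / η) := by field_simp
    have h2 : 0 < l' / η := by positivity
    calc l' = η * (l' / η) := h1
      _ ≤ η * (1 + (1 + l' / η)) ^ 2 := by gcongr; nlinarith
  set C := (1 + K) ^ (m + 3) with hC
  have hC0 : 0 < C := by positivity
  set I0 := ∫ r in (0:ℝ)..R, (R - r) ^ (m + 1) with hI0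
  have hI0p : 0 < I0 := by
    apply intervalIntegral.intervalIntegral_pos_of_pos_on
      (Continuous.intervalIntegrable (by fun_prop) _ _) _ hR
    intro r hr
    have : 0 < R - r := by linarith [hr.2]
    positivity
  have ev : ∀ᶠ ε in nhdsWithin (0:ℝ) (Ioi 0), 0 < ε ∧ ε < R ∧ ε < 1 ∧ ε ^ 2 < R ^ 3 ∧
      ε * C < η * I0 ∧ ε * C < η * l * I0 ∧ (l' * R + C) * ε ^ 2 / R ^ 3 < δ := by
    have key : ∀ (g : ℝ → ℝ) (c : ℝ), Continuous g → g 0 = 0 → 0 < c →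
        ∀ᶠ ε in nhdsWithin (0:ℝ) (Ioi 0), g ε < c := by
      intro g c hg h0 hc
      exact ((hg.tendsto' 0 0 h0).mono_left nhdsWithin_le_nhds).eventually (gt_mem_nhds hc)
    filter_upwards [self_mem_nhdsWithin, key (fun x => x) R continuous_id rfl hR,
      key (fun x => x) 1 continuous_id rfl one_pos,
      key (fun x => x ^ 2) (R ^ 3) (by fun_prop) (by simp) (by positivity),
      key (fun x => x * C) (η * I0) (by fun_prop) (by simp) (by positivity),
      key (fun x => x * C) (η * l * I0) (by fun_prop) (by simp) (by positivity),
      key (fun x => (l' * R + C) * x ^ 2 / R ^ 3) δ (by fun_prop) (by simp) hδ]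
      with ε h1 h2 h3 h4 h5 h6 h7
    exact ⟨h1, h2, h3, h4, h5, h6, h7⟩
  obtain ⟨ε, hε, hεR, hε1, hεR3, hεI, hεl, hεδ⟩ := ev.exists
  set A := K / ε ^ 2 with hA
  have hA0 : 0 ≤ A := by positivity
  have hAK : A * ε ^ 2 = K := by rw [hA]; field_simp
  obtain ⟨lo1, up1⟩ := hB hR hA0 hε hεR.le hε1.le hη (by linarith) hAK m k hl0 (hll.trans hK)
  obtain ⟨lo2, up2⟩ := hB hR hA0 hε hεR.le hε1.le hη (by linarith) hAK m (k + 1) hl'0 hK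
  rw [← hl, ← hC] at lo1 up1
  rw [← hl', ← hC] at lo2 up2
  refine ⟨prof R A, prof_H hR hA0, ?_⟩
  set s := steklov R (m + 4) k (prof R A)
  set s' := steklov R (m + 4) (k + 1) (prof R A)
  have hcm : Continuous fun r => prof R A r ^ (m + 1) := (prof_cont R A).pow _
  set I := ∫ r in (0:ℝ)..R, prof R A r ^ (m + 1) with hI
  have hII : I0 ≤ I := by
    apply intervalIntegral.integral_mono_on hR.le
      (Continuous.intervalIntegrable (by fun_prop) _ _) (hcm.intervalIntegrable _ _)
    intro r hr
    have : 0 ≤ R - r := by linarith [hr.2]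
    apply pow_le_pow_left₀ this
    unfold prof
    have : 0 ≤ A * (R - r) ^ 3 := by positivity
    linarith
  have hIp : 0 < I := hI0p.trans_le hII
  have hIu : I ≤ R * prof R A 0 ^ (m + 1) := by
    have h1 : I ≤ ∫ r in (0:ℝ)..R, prof R A 0 ^ (m + 1) := by
      apply intervalIntegral.integral_mono_on hR.le (hcm.intervalIntegrable _ _) (by simp)
      intro r hr
      exact pow_le_pow_left₀ (prof_nonneg hA0 hr.2) (prof_anti hA0 hr.1 hr.2) _
    simpa using h1
  have hpR : R ^ 3 / ε ^ 2 ≤ prof R A 0 := by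
    have : prof R A 0 = R + K * (R ^ 3 / ε ^ 2) := by rw [hA]; unfold prof; ring
    rw [this]
    nlinarith [show 0 < R ^ 3 / ε ^ 2 by positivity]
  have hp1 : 1 ≤ prof R A 0 := by
    refine le_trans ?_ hpR
    rw [one_le_div (by positivity)]; exact hεR3.le
  set p := prof R A 0
  have hp0 : 0 < p := by linarith
  have hD : 0 < p ^ (m + 3) := by positivity
  have hεI' : ε * C ≤ η * I := hεI.le.trans (by gcongr)
  have hεl' : ε * C ≤ η * l * I := hεl.le.trans (by gcongr)
  have lo : ∀ x y : ℝ, 0 < x → x * (1 - η) * (I - ε * C) / p ^ (m + 3) ≤ y →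
      x * ((1 - η) ^ 2 * I) / p ^ (m + 3) ≤ y := by
    intro x y hx h
    refine le_trans ?_ h
    have h1 : 0 ≤ 1 - η := by linarith
    have h2 : (1 - η) * I ≤ I - ε * C := by linarith
    calc x * ((1 - η) ^ 2 * I) / p ^ (m + 3) = x * (1 - η) * ((1 - η) * I) / p ^ (m + 3) := by ring
      _ ≤ _ := by gcongr
  have lo1' := lo _ _ hl0 lo1
  have lo2' := lo _ _ hl'0 lo2
  have h1η : 0 < 1 - η := by linarith
  have hs : 0 < s := lt_of_lt_of_le (by positivity) lo1'
  have up1' : s ≤ l * ((1 + η) * I) / p ^ (m + 3) := by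
    refine up1.trans ?_
    gcongr
    linarith
  constructor
  · have h1 : s' ≤ (l' * R + C) * ε ^ 2 / R ^ 3 := by
      refine up2.trans ?_
      have hpm : 1 ≤ p ^ (m + 1) := one_le_pow₀ hp1
      have h2 : l' * I + ε * C ≤ (l' * R + C) * p ^ (m + 1) := by
        have h3 : ε * C ≤ C * p ^ (m + 1) := by nlinarith
        have h4 := mul_le_mul_of_nonneg_left hIu hl'0.le
        linarith
      calc (l' * I + ε * C) / p ^ (m + 3) ≤ ((l' * R + C) * p ^ (m + 1)) / p ^ (m + 3) := by gcongr
        _ = (l' * R + C) / p ^ 2 := by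
            field_simp
            ring
        _ ≤ (l' * R + C) / p := by
            gcongr
            exact le_self_pow₀ hp1 two_ne_zero
        _ ≤ (l' * R + C) / (R ^ 3 / ε ^ 2) := by gcongr
        _ = _ := by field_simp
    linarith
  · have h1 : l' / l * (1 - 3 * η) ≤ s' / s := by
      rw [le_div_iff₀ hs]
      refine le_trans ?_ lo2'
      by_cases h3 : 0 ≤ 1 - 3 * η
      · calc l' / l * (1 - 3 * η) * s ≤ l' / l * (1 - 3 * η) * (l * ((1 + η) * I) / p ^ (m + 3)) := by
              gcongr
          _ = l' * (((1 - 3 * η) * (1 + η)) * I) / p ^ (m + 3) := by field_simp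
          _ ≤ _ := by
              gcongr
              nlinarith
      · have h4 : 0 ≤ l' * ((1 - η) ^ 2 * I) / p ^ (m + 3) := by positivity
        have h5 : l' / l * (1 - 3 * η) * s ≤ 0 :=
          mul_nonpos_of_nonpos_of_nonneg
            (mul_nonpos_of_nonneg_of_nonpos (by positivity) (by linarith)) hs.le
        linarith
    have h2 : l' / l * (1 - 3 * η) = l' / l - l' / l * (3 * η) := by ring
    show l' / l - δ < s' / s
    linarith
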